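/- Let P be a polynomial with complex coefficients of degree n, let a be a complex number with |a| ≤ 1, and let α be a complex number with |α| ≤ 1. Then for every real R ≥ 1 and every complex z with |z| ≥ 1, |S̃_a[P](Rz) − α·S̃_a[P](z)| ≤ |R^n − α| · n|z|^(n−1) · max_{|w|=1} |P(w)|. -/

import Mathlib

open Polynomial

/-- The modified Smirnov operator: S̃ₐ[P](z) = (1+az)·P′(z) − n·a·P(z). -/
noncomputable def smirnov (n : ℕ) (a : ℂ) (P : Polynomial ℂ) (z : ℂ) : ℂ :=
  (1 + a * z) * P.derivative.eval z - (n : ℂ) * a * P.eval z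

/-- The maximum of ‖P‖ on the unit circle. -/
noncomputable def maxCircle (P : Polynomial ℂ) : ℝ :=
  sSup {y : ℝ | ∃ w : ℂ, ‖w‖ = 1 ∧ y = ‖P.eval w‖}

/-- A polynomial of degree at most `m` bounded by `M` on the unit circle has its degree-`m`
reversal bounded by `M` on the closed unit disc. -/
theorem norm_eval_reflect_le {Q : ℂ[X]} {m : ℕ} {M : ℝ} (hm : Q.natDegree ≤ m)
    (hM : ∀ w : ℂ, ‖w‖ = 1 → ‖Q.eval w‖ ≤ M) {u : ℂ} (hu : ‖u‖ ≤ 1) :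
    ‖(reflect m Q).eval u‖ ≤ M := by
  refine Complex.norm_le_of_forall_mem_frontier_norm_le (U := Metric.ball (0 : ℂ) 1)
    (f := fun u => (reflect m Q).eval u) Metric.isBounded_ball
    (reflect m Q).differentiable.diffContOnCl (fun w hw => ?_) ?_
  · rw [frontier_ball _ one_ne_zero, mem_sphere_zero_iff_norm] at hw
    have hw0 : w ≠ 0 := by rintro rfl; simp at hw
    have : Invertible w⁻¹ := invertibleOfNonzero (inv_ne_zero hw0)
    have h := eval₂_reflect_mul_pow (RingHom.id ℂ) w⁻¹ m Q hm
    simp only [invOf_eq_inv, inv_inv] at h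
    have h' := congrArg norm h
    rw [norm_mul, norm_pow, norm_inv, hw] at h'
    simp only [inv_one, one_pow, mul_one] at h'
    exact h'.trans_le (hM _ (by simp [hw]))
  · rw [closure_ball _ one_ne_zero]
    simpa using hu

theorem norm_coeff_le {Q : ℂ[X]} {m : ℕ} {M : ℝ} (hm : Q.natDegree ≤ m)
    (hM : ∀ w : ℂ, ‖w‖ = 1 → ‖Q.eval w‖ ≤ M) : ‖Q.coeff m‖ ≤ M := by
  have h := norm_eval_reflect_le hm hM (u := 0) (by simp)
  rwa [← coeff_zero_eq_eval_zero, coeff_reflect, revAt_zero] at h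

/-- Growth of a polynomial outside the unit disc (Bernstein–Walsh). -/
theorem norm_eval_le_mul_pow {Q : ℂ[X]} {m : ℕ} {M : ℝ} (hm : Q.natDegree ≤ m)
    (hM : ∀ w : ℂ, ‖w‖ = 1 → ‖Q.eval w‖ ≤ M) {z : ℂ} (hz : 1 ≤ ‖z‖) :
    ‖Q.eval z‖ ≤ M * ‖z‖ ^ m := by
  have hz0 : z ≠ 0 := by rintro rfl; norm_num at hz
  have : Invertible z := invertibleOfNonzero hz0
  have h := eval₂_reflect_mul_pow (RingHom.id ℂ) z m Q hm
  rw [invOf_eq_inv] at h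
  have h' := congrArg norm h
  rw [norm_mul, norm_pow] at h'
  have hr := norm_eval_reflect_le hm hM (u := z⁻¹) (by rw [norm_inv]; exact inv_le_one_of_one_le₀ hz)
  calc ‖Q.eval z‖ = ‖(reflect m Q).eval z⁻¹‖ * ‖z‖ ^ m := h'.symm
    _ ≤ _ := by gcongr

theorem eval_sub_C_mul_X_pow_ne_zero {Q : ℂ[X]} {m : ℕ} {M : ℝ} (hm : Q.natDegree ≤ m)
    (hM : ∀ w : ℂ, ‖w‖ = 1 → ‖Q.eval w‖ ≤ M) {K : ℂ} (hK : M < ‖K‖) {z : ℂ} (hz : 1 ≤ ‖z‖) :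
    (Q - C K * X ^ m).eval z ≠ 0 := by
  intro h
  have h1 : Q.eval z = K * z ^ m := by simpa [sub_eq_zero] using h
  have h2 := norm_eval_le_mul_pow hm hM hz
  rw [h1, norm_mul, norm_pow] at h2
  have h3 : 0 < ‖z‖ ^ m := by positivity
  exact absurd (le_of_mul_le_mul_right h2 h3) (not_le.2 hK)

theorem natDegree_sub_C_mul_X_pow {Q : ℂ[X]} {m : ℕ} {M : ℝ} (hm : Q.natDegree ≤ m)
    (hM : ∀ w : ℂ, ‖w‖ = 1 → ‖Q.eval w‖ ≤ M) {K : ℂ} (hK : M < ‖K‖) :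
    (Q - C K * X ^ m).natDegree = m := by
  refine natDegree_eq_of_le_of_coeff_ne_zero
    ((natDegree_sub_le _ _).trans (max_le hm (natDegree_C_mul_X_pow_le _ _))) fun h => ?_
  have h1 : Q.coeff m = K := by simpa [sub_eq_zero] using h
  exact absurd (h1 ▸ norm_coeff_le hm hM) (not_le.2 hK)

theorem norm_lt_one_of_mem_roots {F : ℂ[X]} (hF : ∀ z : ℂ, 1 ≤ ‖z‖ → F.eval z ≠ 0)
    {w : ℂ} (hw : w ∈ F.roots) : ‖w‖ < 1 := by
  by_contra! h
  exact hF w h (isRoot_of_mem_roots hw)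

theorem norm_le_mul_norm_of_forall_sub_mul_ne_zero {A B : ℂ} {M : ℝ} (hB : B ≠ 0)
    (h : ∀ K : ℂ, M < ‖K‖ → A - K * B ≠ 0) : ‖A‖ ≤ M * ‖B‖ := by
  by_contra! hlt
  refine h (A / B) ?_ (by rw [div_mul_cancel₀ A hB, sub_self])
  rwa [norm_div, lt_div_iff₀ (norm_pos_iff.2 hB)]

theorem norm_sub_lt_norm_mul_sub {R : ℝ} (hR : 1 < R) {z w : ℂ} (hz : 1 ≤ ‖z‖) (hw : ‖w‖ < 1) :
    ‖z - w‖ < ‖(R : ℂ) * z - w‖ := by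
  have h1 : z.re * w.re + z.im * w.im ≤ ‖z‖ * ‖w‖ := by
    have := Complex.re_le_norm (z * (starRingEnd ℂ) w)
    simpa [Complex.mul_re] using this
  have h2 : ‖z‖ * ‖w‖ < ‖z‖ * ‖z‖ := mul_lt_mul_of_pos_left (hw.trans_le hz) (by positivity)
  have h3 : ‖z‖ * ‖z‖ = z.re * z.re + z.im * z.im := by
    rw [← sq, Complex.sq_norm, Complex.normSq_apply]
  refine lt_of_pow_lt_pow_left₀ 2 (norm_nonneg _) ?_
  rw [Complex.sq_norm, Complex.sq_norm, Complex.normSq_apply, Complex.normSq_apply]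
  simp only [Complex.sub_re, Complex.sub_im, Complex.re_ofReal_mul, Complex.im_ofReal_mul]
  nlinarith [mul_pos (sub_pos.2 hR) (sub_pos.2 (h1.trans_lt h2)),
    mul_pos (sub_pos.2 hR) (sub_pos.2 hR), mul_self_nonneg ‖z‖,
    mul_nonneg (mul_pos (sub_pos.2 hR) (sub_pos.2 hR)).le (mul_self_nonneg ‖z‖)]

theorem norm_eval_lt_norm_eval_mul {F : ℂ[X]} (hF : ∀ z : ℂ, 1 ≤ ‖z‖ → F.eval z ≠ 0)
    (hdeg : F.natDegree ≠ 0) {R : ℝ} (hR : 1 < R) {z : ℂ} (hz : 1 ≤ ‖z‖) :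
    ‖F.eval z‖ < ‖F.eval ((R : ℂ) * z)‖ := by
  have hs := IsAlgClosed.splits F
  have hlead : 0 < ‖F.leadingCoeff‖ := by
    rw [norm_pos_iff, leadingCoeff_ne_zero]
    rintro rfl
    simp at hdeg
  have hprod : ∀ x : ℂ, ‖F.eval x‖ = ‖F.leadingCoeff‖ * (F.roots.map fun w => ‖x - w‖).prod := by
    intro x
    rw [hs.eval_eq_prod_roots, norm_mul]
    congr 1
    simpa [Multiset.map_map] using
      map_multiset_prod (normHom : ℂ →*₀ ℝ) (F.roots.map fun w => x - w)
  rw [hprod, hprod]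
  refine mul_lt_mul_of_pos_left ?_ hlead
  have hroots : ∀ w ∈ F.roots, ‖w‖ < 1 := fun w hw => norm_lt_one_of_mem_roots hF hw
  have hne : F.roots ≠ 0 := by
    rw [← Multiset.card_pos, splits_iff_card_roots.1 hs]
    exact Nat.pos_of_ne_zero hdeg
  obtain ⟨w₀, hw₀⟩ := Multiset.exists_mem_of_ne_zero hne
  obtain ⟨s, hs⟩ := Multiset.exists_cons_of_mem hw₀
  rw [hs] at hroots ⊢
  simp only [Multiset.map_cons, Multiset.prod_cons]
  refine mul_lt_mul (norm_sub_lt_norm_mul_sub hR hz (hroots _ (by simp)))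
    (Multiset.prod_map_le_prod_map₀ _ _ (fun _ _ => norm_nonneg _) fun w hw =>
      (norm_sub_lt_norm_mul_sub hR hz (hroots _ (by simp [hw]))).le) ?_ (norm_nonneg _)
  refine Multiset.prod_pos fun b hb => ?_
  obtain ⟨w, hw, rfl⟩ := Multiset.mem_map.1 hb
  rw [norm_pos_iff, sub_ne_zero]
  rintro rfl
  exact absurd (hroots z (by simp [hw])) (not_lt.2 hz)

/-- Comparison of the values of a polynomial at `R z` and `z` (Aziz–Rather). -/
theorem norm_eval_mul_sub_le {Q : ℂ[X]} {m : ℕ} {M : ℝ} (hm : Q.natDegree ≤ m)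
    (hM : ∀ w : ℂ, ‖w‖ = 1 → ‖Q.eval w‖ ≤ M) {α : ℂ} (hα : ‖α‖ ≤ 1) {R : ℝ} (hR : 1 ≤ R)
    {z : ℂ} (hz : 1 ≤ ‖z‖) :
    ‖Q.eval ((R : ℂ) * z) - α * Q.eval z‖ ≤ M * (‖(R : ℂ) ^ m - α‖ * ‖z‖ ^ m) := by
  have hgrowth := norm_eval_le_mul_pow hm hM hz
  rcases eq_or_ne m 0 with rfl | hm0
  · have hQ : Q = C (Q.coeff 0) := eq_C_of_natDegree_le_zero hm
    rw [hQ] at hgrowth ⊢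
    simp only [eval_C, pow_zero, mul_one] at hgrowth ⊢
    rw [← one_sub_mul, norm_mul, mul_comm]
    gcongr
  rcases hR.eq_or_lt with rfl | hR
  · simp only [Complex.ofReal_one, one_mul, one_pow]
    rw [← one_sub_mul, norm_mul]
    calc _ ≤ ‖1 - α‖ * (M * ‖z‖ ^ m) := by gcongr
      _ = _ := by ring
  have hz0 : z ≠ 0 := by rintro rfl; norm_num at hz
  have hRm : (R : ℂ) ^ m - α ≠ 0 := by
    rw [sub_ne_zero]
    rintro rfl
    rw [norm_pow, Complex.norm_real, Real.norm_of_nonneg (by linarith)] at hα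
    exact absurd hα (not_le.2 (one_lt_pow₀ hR hm0))
  rw [← norm_pow, ← norm_mul]
  refine norm_le_mul_norm_of_forall_sub_mul_ne_zero (mul_ne_zero hRm (pow_ne_zero _ hz0))
    fun K hK h => ?_
  have hlt := norm_eval_lt_norm_eval_mul
    (fun z hz => eval_sub_C_mul_X_pow_ne_zero hm hM hK hz)
    (by rwa [natDegree_sub_C_mul_X_pow hm hM hK]) hR hz
  have heq : (Q - C K * X ^ m).eval ((R : ℂ) * z) = α * (Q - C K * X ^ m).eval z := by
    simp only [eval_sub, eval_mul, eval_C, eval_pow, eval_X]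
    linear_combination h
  rw [heq, norm_mul] at hlt
  nlinarith [norm_nonneg ((Q - C K * X ^ m).eval z)]

theorem half_lt_re_div_sub {z w : ℂ} (hwz : ‖w‖ < ‖z‖) : 1 / 2 < (z / (z - w)).re := by
  have hne : z - w ≠ 0 := by
    rw [sub_ne_zero]
    rintro rfl
    exact lt_irrefl _ hwz
  have h1 : ‖z / (z - w) - 1‖ < ‖z / (z - w)‖ := by
    have : z / (z - w) - 1 = w / (z - w) := by field_simp; ring
    rw [this, norm_div, norm_div]
    exact div_lt_div_of_pos_right hwz (norm_pos_iff.2 hne)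
  have h2 := pow_lt_pow_left₀ h1 (norm_nonneg _) two_ne_zero
  rw [Complex.sq_norm, Complex.sq_norm, Complex.normSq_apply, Complex.normSq_apply] at h2
  simp only [Complex.sub_re, Complex.sub_im, Complex.one_re, Complex.one_im] at h2
  linarith

theorem half_natDegree_lt_re_mul_logDeriv {F : ℂ[X]} (hF : ∀ z : ℂ, 1 ≤ ‖z‖ → F.eval z ≠ 0)
    (hdeg : F.natDegree ≠ 0) {z : ℂ} (hz : 1 ≤ ‖z‖) :
    (F.natDegree : ℝ) / 2 < (z * (F.derivative.eval z / F.eval z)).re := by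
  have hs := IsAlgClosed.splits F
  rw [hs.eval_derivative_div_eval_of_ne_zero (hF z hz), ← Multiset.sum_map_mul_left,
    ← Complex.coe_reAddGroupHom, map_multiset_sum, Multiset.map_map,
    ← splits_iff_card_roots.1 hs]
  have hne : F.roots ≠ ∅ := by
    rw [Multiset.empty_eq_zero, ← Multiset.card_pos, splits_iff_card_roots.1 hs]
    exact Nat.pos_of_ne_zero hdeg
  have h := Multiset.sum_lt_sum_of_nonempty (f := fun _ : ℂ => (1 / 2 : ℝ))
    (g := fun w => (z / (z - w)).re) hne
    fun w hw => half_lt_re_div_sub ((norm_lt_one_of_mem_roots hF hw).trans_le hz)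
  simpa [div_eq_mul_inv] using h

theorem smirnov_ne_zero {F : ℂ[X]} (hF : ∀ z : ℂ, 1 ≤ ‖z‖ → F.eval z ≠ 0)
    (hdeg : F.natDegree ≠ 0) {a : ℂ} (ha : ‖a‖ ≤ 1) {z : ℂ} (hz : ‖z‖ = 1) :
    smirnov F.natDegree a F z ≠ 0 := by
  intro h
  have hre := half_natDegree_lt_re_mul_logDeriv hF hdeg hz.ge
  have hFz := hF z hz.ge
  set n := F.natDegree
  set V := z * (F.derivative.eval z / F.eval z) with hV
  have hVF : V * F.eval z = z * F.derivative.eval z := by rw [hV]; field_simp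
  have hn : (0 : ℝ) < n := by exact_mod_cast Nat.pos_of_ne_zero hdeg
  have heq : V = a * z * (n - V) := by
    refine mul_right_cancel₀ hFz ?_
    rw [smirnov] at h
    linear_combination (1 + a * z) * hVF + z * h
  have hle : ‖V‖ ≤ ‖(n : ℂ) - V‖ := by
    calc ‖V‖ = ‖a‖ * ‖z‖ * ‖(n : ℂ) - V‖ := by rw [← norm_mul, ← norm_mul, ← heq]
      _ ≤ 1 * ‖(n : ℂ) - V‖ := by rw [hz, mul_one]; gcongr
      _ = _ := one_mul _
  have h2 := pow_le_pow_left₀ (norm_nonneg _) hle 2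
  rw [Complex.sq_norm, Complex.sq_norm, Complex.normSq_apply, Complex.normSq_apply] at h2
  simp only [Complex.sub_re, Complex.sub_im, Complex.natCast_re, Complex.natCast_im] at h2
  nlinarith [mul_pos hn (sub_pos.2 hre)]

/-- A Bernstein-type inequality for the modified Smirnov operator. -/
theorem norm_smirnov_le {P : ℂ[X]} {n : ℕ} {M : ℝ} (hn : P.natDegree ≤ n) (hn0 : n ≠ 0)
    (hM : ∀ w : ℂ, ‖w‖ = 1 → ‖P.eval w‖ ≤ M) {a : ℂ} (ha : ‖a‖ ≤ 1) {z : ℂ} (hz : ‖z‖ = 1) :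
    ‖smirnov n a P z‖ ≤ M * n := by
  have hz0 : z ≠ 0 := by rintro rfl; simp at hz
  have hB : ‖(n : ℂ) * z ^ (n - 1)‖ = n := by simp [hz]
  rw [← hB]
  refine norm_le_mul_norm_of_forall_sub_mul_ne_zero
    (mul_ne_zero (Nat.cast_ne_zero.2 hn0) (pow_ne_zero _ hz0)) fun K hK h => ?_
  have hdeg := natDegree_sub_C_mul_X_pow hn hM hK
  refine smirnov_ne_zero (fun z hz => eval_sub_C_mul_X_pow_ne_zero hn hM hK hz)
    (by rwa [hdeg]) ha hz ?_
  rw [hdeg, ← h, smirnov, smirnov]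
  have hpow : z ^ n = z * z ^ (n - 1) := (mul_pow_sub_one hn0 z).symm
  simp only [derivative_sub, derivative_C_mul, derivative_X_pow, eval_sub, eval_mul, eval_C,
    eval_pow, eval_X, hpow]
  ring

/-- The modified Smirnov operator as a polynomial. -/
noncomputable def smirnovPoly (n : ℕ) (a : ℂ) (P : ℂ[X]) : ℂ[X] :=
  P.derivative + C a * (X * P.derivative) - C (n * a) * P

theorem eval_smirnovPoly (n : ℕ) (a : ℂ) (P : ℂ[X]) (z : ℂ) :
    (smirnovPoly n a P).eval z = smirnov n a P z := by
  simp only [smirnovPoly, smirnov, eval_sub, eval_add, eval_mul, eval_C, eval_X]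
  ring

theorem natDegree_smirnovPoly_le {n : ℕ} {P : ℂ[X]} (hP : P.natDegree ≤ n) (hn : n ≠ 0) (a : ℂ) :
    (smirnovPoly n a P).natDegree ≤ n - 1 := by
  rw [natDegree_le_iff_coeff_eq_zero]
  intro N hN
  obtain ⟨k, rfl⟩ : ∃ k, N = k + 1 := Nat.exists_eq_succ_of_ne_zero (by omega)
  have h1 : P.coeff (k + 1 + 1) = 0 := coeff_eq_zero_of_natDegree_lt (by omega)
  simp only [smirnovPoly, coeff_sub, coeff_add, coeff_C_mul, coeff_X_mul, coeff_derivative, h1]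
  rcases eq_or_ne n (k + 1) with rfl | hne
  · push_cast
    ring
  · have h2 : P.coeff (k + 1) = 0 := coeff_eq_zero_of_natDegree_lt (by omega)
    simp [h2]

theorem norm_eval_le_maxCircle (P : ℂ[X]) {w : ℂ} (hw : ‖w‖ = 1) :
    ‖P.eval w‖ ≤ maxCircle P := by
  refine le_csSup ?_ ⟨w, hw, rfl⟩
  obtain ⟨B, hB⟩ := (isCompact_sphere (0 : ℂ) 1).exists_bound_of_continuousOn
    P.continuous.continuousOn
  refine ⟨B, ?_⟩
  rintro _ ⟨w, hw, rfl⟩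
  exact hB w (by simpa using hw)

theorem norm_ofReal_sub_le_of_le {x y : ℝ} {α : ℂ} (hα : ‖α‖ ≤ x) (hxy : x ≤ y) :
    ‖(x : ℂ) - α‖ ≤ ‖(y : ℂ) - α‖ := by
  have hre : α.re ≤ x := (Complex.re_le_norm α).trans hα
  refine le_of_sq_le_sq ?_ (norm_nonneg _)
  rw [Complex.sq_norm, Complex.sq_norm, Complex.normSq_apply, Complex.normSq_apply]
  simp only [Complex.sub_re, Complex.sub_im, Complex.ofReal_re, Complex.ofReal_im]
  nlinarith

theorem statement16 (n : ℕ) (P : Polynomial ℂ) (hP : P.natDegree = n)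
    (a α : ℂ) (ha : ‖a‖ ≤ 1) (hα : ‖α‖ ≤ 1)
    (R : ℝ) (hR : 1 ≤ R) (z : ℂ) (hz : 1 ≤ ‖z‖) :
    ‖smirnov n a P ((R : ℂ) * z) - α * smirnov n a P z‖
      ≤ ‖(R : ℂ) ^ n - α‖ * ((n : ℝ) * ‖z‖ ^ (n - 1)) * maxCircle P := by
  rcases eq_or_ne n 0 with rfl | hn
  · have hd : P.derivative = 0 := derivative_of_natDegree_zero hP
    simp [smirnov, hd]
  have hM : ∀ w : ℂ, ‖w‖ = 1 → ‖P.eval w‖ ≤ maxCircle P := fun w => norm_eval_le_maxCircle P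
  have hM0 : 0 ≤ maxCircle P := (norm_nonneg _).trans (hM 1 (by simp))
  have h := norm_eval_mul_sub_le (natDegree_smirnovPoly_le hP.le hn a)
    (fun w hw => (eval_smirnovPoly n a P w).symm ▸ norm_smirnov_le hP.le hn hM ha hw) hα hR hz
  rw [eval_smirnovPoly, eval_smirnovPoly] at h
  have hpow : ‖(R : ℂ) ^ (n - 1) - α‖ ≤ ‖(R : ℂ) ^ n - α‖ := by
    have := norm_ofReal_sub_le_of_le (hα.trans (one_le_pow₀ hR (n := n - 1)))
      (pow_le_pow_right₀ hR (Nat.sub_le n 1))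
    exact_mod_cast this
  calc _ ≤ _ := h
    _ ≤ maxCircle P * n * (‖(R : ℂ) ^ n - α‖ * ‖z‖ ^ (n - 1)) := by gcongr
    _ = _ := by ring
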